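/- Let p : ℝ^d → (0,∞), h : ℝ^d → ℝ and φ : ℝ^d → ℝ be infinitely differentiable, let ĥ ∈ ℝ, and suppose −∑_i ∂/∂x_i(p ∂φ/∂x_i) = (h − ĥ)p on ℝ^d. For σ ∈ {1,…,d}^l write ∇^l_σ φ = ∂^l φ/∂x_{σ(1)}⋯∂x_{σ(l)}, and let G^l_σ be defined recursively by G¹_{(σ(1))} = ∑_i (∂²(log p)/∂x_i∂x_{σ(1)})(∂φ/∂x_i) + ∂h/∂x_{σ(1)} and G^l_σ = ∑_i (∂²(log p)/∂x_i∂x_{σ(l)}) ∂/∂x_i(∇^{l−1}_{σ|_{1:l−1}}φ) + ∂G^{l−1}_{σ|_{1:l−1}}/∂x_{σ(l)} for l ≥ 2. Fix l ≥ 1 and assume that for every σ ∈ {1,…,d}^l the integrals ∫ |∇^l_σ φ|² p dx, ∫ |∇(∇^l_σ φ)|² p dx, and ∫ |G^l_σ|² p dx are all finite. Then ∑_{σ ∈ {1,…,d}^{l+1}} ∫_{ℝ^d} |∇^{l+1}_σ φ|² p dx ≤ ∑_{σ ∈ {1,…,d}^l} ∫_{ℝ^d} |∇^l_σ φ|² p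 dx + ∑_{σ ∈ {1,…,d}^l} ∫_{ℝ^d} |G^l_σ|² p dx. -/

import Mathlib

open MeasureTheory
open scoped ContDiff

/-- Partial derivative `∂f/∂x_i` of a scalar function on `ℝ^d`. -/
noncomputable def pd {d : ℕ} (i : Fin d) (f : (Fin d → ℝ) → ℝ) (x : Fin d → ℝ) : ℝ :=
  fderiv ℝ f x (Pi.single i 1)

/-- Iterated partial derivative `∇^l_σ f = ∂^l f/∂x_{σ(1)}⋯∂x_{σ(l)}`. -/
noncomputable def iterD {d : ℕ} :
    (l : ℕ) → (Fin l → Fin d) → ((Fin d → ℝ) → ℝ) → ((Fin d → ℝ) → ℝ)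
  | 0, _, f => f
  | l + 1, σ, f => pd (σ (Fin.last l)) (iterD l (σ ∘ Fin.castSucc) f)

/-- The functions `G^l_σ` of the paper (Lemma 2, Appendix D), defined recursively:
`G¹_{σ(1)} = ∑_i ∂²_{i,σ(1)}(log p) ∂_i φ + ∂_{σ(1)} h` and
`G^l_σ = ∑_i ∂²_{i,σ(l)}(log p) ∂_i (∇^{l−1}_{σ|_{1:l−1}} φ) + ∂_{σ(l)} G^{l−1}_{σ|_{1:l−1}}`.
Here `Gfun p h φ l σ` with `σ : Fin (l+1) → Fin d` is `G^{l+1}_σ`. -/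
noncomputable def Gfun {d : ℕ} (p h φ : (Fin d → ℝ) → ℝ) :
    (l : ℕ) → (Fin (l + 1) → Fin d) → (Fin d → ℝ) → ℝ
  | 0, σ => fun x =>
      (∑ i, pd i (pd (σ 0) (fun y => Real.log (p y))) x * pd i φ x) + pd (σ 0) h x
  | l + 1, σ => fun x =>
      (∑ i, pd i (pd (σ (Fin.last (l + 1))) (fun y => Real.log (p y))) x *
          pd i (iterD (l + 1) (σ ∘ Fin.castSucc) φ) x)
        + pd (σ (Fin.last (l + 1))) (Gfun p h φ l (σ ∘ Fin.castSucc)) x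

section Helpers

variable {d : ℕ}

lemma pd_contDiff {f : (Fin d → ℝ) → ℝ} (hf : ContDiff ℝ ∞ f) (i : Fin d) :
    ContDiff ℝ ∞ (pd i f) := by
  unfold pd
  exact (hf.fderiv_right (m := ∞) (by simp)).clm_apply contDiff_const

lemma cd_diff {f : (Fin d → ℝ) → ℝ} (hf : ContDiff ℝ ∞ f) (x : Fin d → ℝ) :
    DifferentiableAt ℝ f x := hf.differentiable (by simp) x

lemma pd_mul {f g : (Fin d → ℝ) → ℝ} (hf : ContDiff ℝ ∞ f) (hg : ContDiff ℝ ∞ g)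
    (i : Fin d) (x : Fin d → ℝ) :
    pd i (fun y => f y * g y) x = pd i f x * g x + f x * pd i g x := by
  unfold pd
  rw [fderiv_fun_mul (cd_diff hf x) (cd_diff hg x)]
  simp
  ring

lemma pd_add {f g : (Fin d → ℝ) → ℝ} (hf : ContDiff ℝ ∞ f) (hg : ContDiff ℝ ∞ g)
    (i : Fin d) (x : Fin d → ℝ) :
    pd i (fun y => f y + g y) x = pd i f x + pd i g x := by
  unfold pd
  rw [fderiv_fun_add (cd_diff hf x) (cd_diff hg x)]
  simp

lemma pd_sum {f : Fin d → (Fin d → ℝ) → ℝ} (hf : ∀ j, ContDiff ℝ ∞ (f j))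
    (i : Fin d) (x : Fin d → ℝ) :
    pd i (fun y => ∑ j, f j y) x = ∑ j, pd i (f j) x := by
  unfold pd
  rw [fderiv_fun_sum (fun j _ => cd_diff (hf j) x)]
  simp

lemma pd_comm {f : (Fin d → ℝ) → ℝ} (hf : ContDiff ℝ ∞ f) (i j : Fin d) (x : Fin d → ℝ) :
    pd i (pd j f) x = pd j (pd i f) x := by
  have h1 : ContDiff ℝ ∞ (fderiv ℝ f) := hf.fderiv_right (m := ∞) (by simp)
  have h2 : DifferentiableAt ℝ (fderiv ℝ f) x := h1.differentiable (by simp) x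
  have hs : IsSymmSndFDerivAt ℝ f x :=
    (hf.contDiffAt).isSymmSndFDerivAt (by simp; exact WithTop.coe_le_coe.2 le_top)
  have key : ∀ v w : Fin d → ℝ,
      fderiv ℝ (fun y => fderiv ℝ f y v) x w = fderiv ℝ (fderiv ℝ f) x w v := by
    intro v w
    rw [fderiv_clm_apply h2 (differentiableAt_const v)]
    simp
  change fderiv ℝ (fun y => fderiv ℝ f y (Pi.single j 1)) x (Pi.single i 1) =
    fderiv ℝ (fun y => fderiv ℝ f y (Pi.single i 1)) x (Pi.single j 1)
  rw [key, key]
  exact hs _ _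

lemma iterD_contDiff {f : (Fin d → ℝ) → ℝ} (hf : ContDiff ℝ ∞ f) :
    ∀ (l : ℕ) (σ : Fin l → Fin d), ContDiff ℝ ∞ (iterD l σ f)
  | 0, _ => hf
  | l + 1, σ => pd_contDiff (iterD_contDiff hf l _) _

lemma log_contDiff {p : (Fin d → ℝ) → ℝ} (hp : ContDiff ℝ ∞ p) (hppos : ∀ x, 0 < p x) :
    ContDiff ℝ ∞ (fun y => Real.log (p y)) :=
  hp.log (fun x => (hppos x).ne')

lemma pd_eq_mul_log {p : (Fin d → ℝ) → ℝ} (hp : ContDiff ℝ ∞ p) (hppos : ∀ x, 0 < p x)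
    (i : Fin d) (x : Fin d → ℝ) :
    pd i p x = p x * pd i (fun y => Real.log (p y)) x := by
  unfold pd
  rw [fderiv.log (cd_diff hp x) (hppos x).ne']
  have := (hppos x).ne'
  simp
  field_simp

lemma Gfun_contDiff {p h φ : (Fin d → ℝ) → ℝ} (hp : ContDiff ℝ ∞ p) (hh : ContDiff ℝ ∞ h)
    (hφ : ContDiff ℝ ∞ φ) (hppos : ∀ x, 0 < p x) :
    ∀ (l : ℕ) (σ : Fin (l + 1) → Fin d), ContDiff ℝ ∞ (Gfun p h φ l σ)
  | 0, σ => by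
      refine ContDiff.add (ContDiff.sum fun i _ => ContDiff.mul ?_ ?_) (pd_contDiff hh _)
      · exact pd_contDiff (pd_contDiff (log_contDiff hp hppos) _) _
      · exact pd_contDiff hφ _
  | l + 1, σ => by
      refine ContDiff.add (ContDiff.sum fun i _ => ContDiff.mul ?_ ?_)
        (pd_contDiff (Gfun_contDiff hp hh hφ hppos l _) _)
      · exact pd_contDiff (pd_contDiff (log_contDiff hp hppos) _) _
      · exact pd_contDiff (iterD_contDiff hφ _ _) _

lemma div_expand {p u : (Fin d → ℝ) → ℝ} (hp : ContDiff ℝ ∞ p) (hu : ContDiff ℝ ∞ u)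
    (hppos : ∀ x, 0 < p x) (x : Fin d → ℝ) :
    ∑ i, pd i (fun y => p y * pd i u y) x =
      (∑ i, (pd i (fun y => Real.log (p y)) x * pd i u x + pd i (pd i u) x)) * p x := by
  rw [Finset.sum_mul]
  refine Finset.sum_congr rfl fun i _ => ?_
  rw [pd_mul hp (pd_contDiff hu i), pd_eq_mul_log hp hppos]
  ring

/-- One differentiation of the weighted Poisson equation. -/
lemma step {p u G : (Fin d → ℝ) → ℝ} (hp : ContDiff ℝ ∞ p) (hu : ContDiff ℝ ∞ u)
    (hG : ContDiff ℝ ∞ G) (hppos : ∀ x, 0 < p x) (c : ℝ)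
    (heq : ∀ x, -∑ i, pd i (fun y => p y * pd i u y) x = (G x - c) * p x)
    (k : Fin d) (x : Fin d → ℝ) :
    -∑ i, pd i (fun y => p y * pd i (pd k u) y) x =
      ((∑ i, pd i (pd k (fun y => Real.log (p y))) x * pd i u x) + pd k G x) * p x := by
  have hL := log_contDiff hp hppos
  set L : (Fin d → ℝ) → ℝ := fun y => Real.log (p y) with hLdef
  have hGeq : (fun y => G y + ∑ i, (pd i L y * pd i u y + pd i (pd i u) y)) = fun _ => c := by
    funext y
    have h1 := heq y
    rw [div_expand hp hu hppos] at h1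
    have h2 := (hppos y).ne'
    have h3 : (G y + ∑ i, (pd i L y * pd i u y + pd i (pd i u) y) - c) * p y = 0 := by
      linear_combination -h1
    rcases mul_eq_zero.1 h3 with h | h
    · linarith
    · exact absurd h h2
  have hterm : ∀ i, ContDiff ℝ ∞ (fun y => pd i L y * pd i u y) := fun i =>
    (pd_contDiff hL i).mul (pd_contDiff hu i)
  have hterm2 : ∀ i, ContDiff ℝ ∞ (fun y => pd i L y * pd i u y + pd i (pd i u) y) := fun i =>
    (hterm i).add (pd_contDiff (pd_contDiff hu i) i)
  have hd : pd k (fun y => G y + ∑ i, (pd i L y * pd i u y + pd i (pd i u) y)) x = 0 := by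
    rw [hGeq]; simp [pd]
  rw [pd_add hG (ContDiff.sum fun i _ => hterm2 i), pd_sum hterm2] at hd
  rw [div_expand hp (pd_contDiff hu k) hppos, ← neg_mul]
  congr 1
  have h5 : ∀ i, pd k (fun y => pd i L y * pd i u y + pd i (pd i u) y) x =
      pd i (pd k L) x * pd i u x + (pd i L x * pd i (pd k u) x + pd i (pd i (pd k u)) x) := by
    intro i
    rw [pd_add (hterm i) (pd_contDiff (pd_contDiff hu i) i),
      pd_mul (pd_contDiff hL i) (pd_contDiff hu i), pd_comm hL k i, pd_comm hu k i,
      pd_comm (pd_contDiff hu i) k i, show pd k (pd i u) = pd i (pd k u) from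
        funext fun y => pd_comm hu k i y]
    ring
  simp_rw [h5] at hd
  rw [Finset.sum_add_distrib] at hd
  linarith

lemma identity {p h φ : (Fin d → ℝ) → ℝ}
    (hp : ContDiff ℝ ∞ p) (hh : ContDiff ℝ ∞ h) (hφ : ContDiff ℝ ∞ φ)
    (hppos : ∀ x, 0 < p x) (hhat : ℝ)
    (heq : ∀ x : Fin d → ℝ,
      -∑ i, pd i (fun y => p y * pd i φ y) x = (h x - hhat) * p x) :
    ∀ (m : ℕ) (σ : Fin (m + 1) → Fin d) (x : Fin d → ℝ),
      -∑ i, pd i (fun y => p y * pd i (iterD (m + 1) σ φ) y) x = Gfun p h φ m σ x * p x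
  | 0, σ, x => step hp hφ hh hppos hhat heq (σ 0) x
  | m + 1, σ, x => by
      refine step hp (iterD_contDiff hφ (m + 1) _) (Gfun_contDiff hp hh hφ hppos m _) hppos 0
        (fun y => ?_) (σ (Fin.last (m + 1))) x
      rw [sub_zero]
      exact identity hp hh hφ hppos hhat heq m _ y

lemma cutoff_zero {p u G χ : (Fin d → ℝ) → ℝ} (hp : ContDiff ℝ ∞ p) (hu : ContDiff ℝ ∞ u)
    (heq : ∀ x, -∑ i, pd i (fun y => p y * pd i u y) x = G x * p x)
    (hχ : ContDiff ℝ ∞ χ) (hc : HasCompactSupport χ) :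
    ∫ x, (χ x * ((∑ i, (pd i u x) ^ 2) * p x - G x * u x * p x)
      + ∑ i, pd i χ x * (u x * (p x * pd i u x))) = 0 := by
  have hg : ∀ i, ContDiff ℝ ∞ (fun x => u x * (p x * pd i u x)) := fun i =>
    hu.mul (hp.mul (pd_contDiff hu i))
  have I1 : ∀ i, Integrable (fun x => χ x * pd i (fun x => u x * (p x * pd i u x)) x) := fun i =>
    (hχ.continuous.mul (pd_contDiff (hg i) i).continuous).integrable_of_hasCompactSupport
      hc.mul_right
  have hc' : ∀ i, HasCompactSupport (pd i χ) := fun i => hc.fderiv_apply ℝ _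
  have I2 : ∀ i, Integrable (fun x => pd i χ x * (u x * (p x * pd i u x))) := fun i =>
    ((pd_contDiff hχ i).continuous.mul (hg i).continuous).integrable_of_hasCompactSupport
      (hc' i).mul_right
  have I3 : ∀ i, Integrable (fun x => χ x * (u x * (p x * pd i u x))) := fun i =>
    (hχ.continuous.mul (hg i).continuous).integrable_of_hasCompactSupport hc.mul_right
  have ibp : ∀ i, ∫ x, χ x * pd i (fun x => u x * (p x * pd i u x)) x =
      - ∫ x, pd i χ x * (u x * (p x * pd i u x)) := fun i =>
    integral_mul_fderiv_eq_neg_fderiv_mul_of_integrable (I2 i) (I1 i) (I3 i)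
      (fun x _ => cd_diff hχ x) (fun x _ => cd_diff (hg i) x)
  have hpt : ∀ x, (χ x * ((∑ i, (pd i u x) ^ 2) * p x - G x * u x * p x)
      + ∑ i, pd i χ x * (u x * (p x * pd i u x))) =
      ∑ i, (χ x * pd i (fun x => u x * (p x * pd i u x)) x
        + pd i χ x * (u x * (p x * pd i u x))) := by
    intro x
    rw [Finset.sum_add_distrib]
    congr 1
    rw [← Finset.mul_sum]
    congr 1
    have : ∀ i, pd i (fun x => u x * (p x * pd i u x)) x =
        (pd i u x) ^ 2 * p x + u x * pd i (fun y => p y * pd i u y) x := by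
      intro i
      rw [pd_mul hu (hp.mul (pd_contDiff hu i))]
      ring
    simp_rw [this]
    rw [Finset.sum_add_distrib, ← Finset.sum_mul, ← Finset.mul_sum]
    linear_combination (u x) * heq x
  simp_rw [hpt]
  rw [integral_finsetSum _ (fun i _ => by exact (I1 i).add (I2 i))]
  refine Finset.sum_eq_zero fun i _ => ?_
  rw [integral_add (I1 i) (I2 i), ibp i]
  ring

lemma energy {p u G : (Fin d → ℝ) → ℝ} (hp : ContDiff ℝ ∞ p) (hu : ContDiff ℝ ∞ u)
    (hG : ContDiff ℝ ∞ G) (hppos : ∀ x, 0 < p x)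
    (heq : ∀ x, -∑ i, pd i (fun y => p y * pd i u y) x = G x * p x)
    (h1 : Integrable (fun x => (u x) ^ 2 * p x))
    (h2 : Integrable (fun x => (∑ i, (pd i u x) ^ 2) * p x))
    (h3 : Integrable (fun x => (G x) ^ 2 * p x)) :
    ∫ x, (∑ i, (pd i u x) ^ 2) * p x ≤ (∫ x, (u x) ^ 2 * p x) + ∫ x, (G x) ^ 2 * p x := by
  have hcu := hu.continuous
  have hcp := hp.continuous
  have hcG := hG.continuous
  have hcpu : ∀ i, Continuous (pd i u) := fun i => (pd_contDiff hu i).continuous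
  have IGu : Integrable (fun x => G x * u x * p x) := by
    refine (h1.add h3).mono' (by fun_prop) (Filter.Eventually.of_forall fun x => ?_)
    simp only [Real.norm_eq_abs, Pi.add_apply]
    rw [abs_mul, abs_of_pos (hppos x), ← add_mul]
    refine mul_le_mul_of_nonneg_right ?_ (hppos x).le
    rw [abs_le]
    constructor <;> nlinarith [sq_nonneg (G x + u x), sq_nonneg (G x - u x), sq_nonneg (G x), sq_nonneg (u x)]
  have Igu : ∀ i, Integrable (fun x => u x * (p x * pd i u x)) := by
    intro i
    refine (h1.add h2).mono' (by fun_prop) (Filter.Eventually.of_forall fun x => ?_)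
    simp only [Real.norm_eq_abs, Pi.add_apply]
    rw [show u x * (p x * pd i u x) = (u x * pd i u x) * p x by ring,
      abs_mul, abs_of_pos (hppos x), ← add_mul]
    refine mul_le_mul_of_nonneg_right ?_ (hppos x).le
    have hs : (pd i u x) ^ 2 ≤ ∑ i, (pd i u x) ^ 2 :=
      Finset.single_le_sum (f := fun i => (pd i u x) ^ 2) (fun j _ => sq_nonneg _)
        (Finset.mem_univ i)
    refine le_trans ?_ (add_le_add_right hs _)
    rw [abs_le]
    constructor <;> nlinarith [sq_nonneg (pd i u x + u x), sq_nonneg (pd i u x - u x), sq_nonneg (pd i u x), sq_nonneg (u x)]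
  obtain ⟨f, -, hfc, hfd, hfr, hf0⟩ :=
    exists_contDiff_tsupport_subset (E := Fin d → ℝ) (n := ⊤) (x := 0) (s := Set.univ)
      Filter.univ_mem
  have hfd : ContDiff ℝ ∞ f := hfd
  obtain ⟨C, hC⟩ := (hfc.fderiv (𝕜 := ℝ)).exists_bound_of_continuous
    (hfd.continuous_fderiv (by simp))
  have hC' : ∀ i x, |pd i f x| ≤ C := by
    intro i x
    refine ((fderiv ℝ f x).le_opNorm _).trans ?_
    have hn : ‖(Pi.single i 1 : Fin d → ℝ)‖ ≤ 1 := by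
      refine (pi_norm_le_iff_of_nonneg zero_le_one).2 fun j => ?_
      by_cases hj : j = i
      · subst hj; simp
      · simp [Pi.single_eq_of_ne hj]
    exact (mul_le_of_le_one_right (norm_nonneg _) hn).trans (hC x)
  have hC0 : 0 ≤ C := (norm_nonneg _).trans (hC 0)
  let r : ℕ → ℝ := fun n => 1 / ((n : ℝ) + 1)
  have hr0 : ∀ n, 0 < r n := fun n => Nat.one_div_pos_of_nat
  have hr1 : ∀ n, r n ≤ 1 := fun n => by
    have : (0:ℝ) ≤ n := n.cast_nonneg
    simp only [r]
    rw [div_le_one (by positivity)]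
    linarith
  have hr : Filter.Tendsto r Filter.atTop (nhds 0) := tendsto_one_div_add_atTop_nhds_zero_nat
  let χ : ℕ → (Fin d → ℝ) → ℝ := fun n x => f (r n • x)
  have hχd : ∀ n, ContDiff ℝ ∞ (χ n) := fun n => hfd.comp (contDiff_const_smul _)
  have hχc : ∀ n, HasCompactSupport (χ n) := fun n => hfc.comp_smul (hr0 n).ne'
  have hχp : ∀ n i x, pd i (χ n) x = r n * pd i f (r n • x) := by
    intro n i x
    simp only [pd, χ]
    rw [fderiv_comp_smul]
    simp
  have hb : ∀ x, |f x| ≤ 1 := fun x => by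
    have := hfr (Set.mem_range_self x)
    rw [abs_of_nonneg this.1]; exact this.2
  have hχp' : ∀ n i x, |pd i (χ n) x| ≤ r n * C := by
    intro n i x
    rw [hχp, abs_mul, abs_of_pos (hr0 n)]
    exact mul_le_mul_of_nonneg_left (hC' i _) (hr0 n).le
  have IA : Integrable (fun x => (∑ i, (pd i u x) ^ 2) * p x - G x * u x * p x) := h2.sub IGu
  have lim := tendsto_integral_of_dominated_convergence (μ := (volume : Measure (Fin d → ℝ)))
    (F := fun n x => (χ n x * ((∑ i, (pd i u x) ^ 2) * p x - G x * u x * p x)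
      + ∑ i, pd i (χ n) x * (u x * (p x * pd i u x))))
    (f := fun x => (∑ i, (pd i u x) ^ 2) * p x - G x * u x * p x)
    (fun x => |(∑ i, (pd i u x) ^ 2) * p x - G x * u x * p x|
      + ∑ i, C * |u x * (p x * pd i u x)|)
    (fun n => by
      have a1 := (hχd n).continuous
      have a2 : ∀ i, Continuous (pd i (χ n)) := fun i => (pd_contDiff (hχd n) i).continuous
      exact Continuous.aestronglyMeasurable (by fun_prop))
    (IA.abs.add (integrable_finsetSum _ fun i _ => ((Igu i).abs.const_mul C)))
    (fun n => Filter.Eventually.of_forall fun x => by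
      refine (norm_add_le _ _).trans (add_le_add ?_ ((norm_sum_le _ _).trans
        (Finset.sum_le_sum fun i _ => ?_)))
      · rw [Real.norm_eq_abs, abs_mul]
        exact mul_le_of_le_one_left (abs_nonneg _) (hb _)
      · rw [Real.norm_eq_abs, abs_mul]
        refine mul_le_mul_of_nonneg_right ((hχp' n i x).trans ?_) (abs_nonneg _)
        exact mul_le_of_le_one_left hC0 (hr1 n))
    (Filter.Eventually.of_forall fun x => by
      have t1 : Filter.Tendsto (fun n => χ n x) Filter.atTop (nhds 1) := by
        have : Filter.Tendsto (fun n => r n • x) Filter.atTop (nhds 0) := by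
          simpa using hr.smul_const x
        rw [← hf0]
        exact (hfd.continuous.tendsto 0).comp this
      have t2 : ∀ i, Filter.Tendsto (fun n => pd i (χ n) x) Filter.atTop (nhds 0) := fun i =>
        squeeze_zero_norm (fun n => hχp' n i x) (by simpa using hr.mul_const C)
      have t3 : Filter.Tendsto (fun n => ∑ i, pd i (χ n) x * (u x * (p x * pd i u x)))
          Filter.atTop (nhds (∑ i : Fin d, 0 * (u x * (p x * pd i u x)))) :=
        tendsto_finsetSum _ fun i _ => (t2 i).mul_const _
      simpa using (t1.mul_const ((∑ i, (pd i u x) ^ 2) * p x - G x * u x * p x)).add t3)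
  have hz : ∀ n, ∫ x, (χ n x * ((∑ i, (pd i u x) ^ 2) * p x - G x * u x * p x)
      + ∑ i, pd i (χ n) x * (u x * (p x * pd i u x))) = 0 := fun n =>
    cutoff_zero hp hu heq (hχd n) (hχc n)
  simp_rw [hz] at lim
  have h0 := tendsto_nhds_unique lim tendsto_const_nhds
  rw [integral_sub h2 IGu] at h0
  have hle : ∫ x, G x * u x * p x ≤ ∫ x, ((u x) ^ 2 * p x + (G x) ^ 2 * p x) := by
    refine integral_mono IGu (h1.add h3) fun x => ?_
    simp only
    rw [← add_mul]
    refine mul_le_mul_of_nonneg_right ?_ (hppos x).le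
    nlinarith [sq_nonneg (G x + u x), sq_nonneg (G x - u x), sq_nonneg (G x), sq_nonneg (u x)]
  rw [integral_add h1 h3] at hle
  linarith

end Helpers

/-- the higher-order a priori estimate (59) of Lemma 3 of the paper.
Let `p, h, φ` be smooth with `p > 0` and `−∑_i ∂_i(p ∂_i φ) = (h − ĥ)p` on `ℝ^d`.
Fix `l = m + 1 ≥ 1` and suppose that for every `σ ∈ {1,…,d}^l` the integrals
`∫ |∇^l_σ φ|² p`, `∫ |∇(∇^l_σ φ)|² p` and `∫ |G^l_σ|² p` are finite.  Then
`∑_{σ ∈ {1,…,d}^{l+1}} ∫ |∇^{l+1}_σ φ|² p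
  ≤ ∑_{σ ∈ {1,…,d}^l} ∫ |∇^l_σ φ|² p + ∑_{σ ∈ {1,…,d}^l} ∫ |G^l_σ|² p`. -/
theorem stmt18 {d : ℕ} (p h φ : (Fin d → ℝ) → ℝ)
    (hp : ContDiff ℝ ∞ p) (hh : ContDiff ℝ ∞ h) (hφ : ContDiff ℝ ∞ φ)
    (hppos : ∀ x, 0 < p x) (hhat : ℝ)
    (heq : ∀ x : Fin d → ℝ,
      -∑ i, pd i (fun y => p y * pd i φ y) x = (h x - hhat) * p x)
    (m : ℕ)
    (hint1 : ∀ σ : Fin (m + 1) → Fin d,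
      Integrable (fun x => (iterD (m + 1) σ φ x) ^ 2 * p x))
    (hint2 : ∀ σ : Fin (m + 1) → Fin d,
      Integrable (fun x => (∑ i, (pd i (iterD (m + 1) σ φ) x) ^ 2) * p x))
    (hint3 : ∀ σ : Fin (m + 1) → Fin d,
      Integrable (fun x => (Gfun p h φ m σ x) ^ 2 * p x)) :
    (∑ σ : Fin (m + 2) → Fin d, ∫ x, (iterD (m + 2) σ φ x) ^ 2 * p x)
      ≤ (∑ σ : Fin (m + 1) → Fin d, ∫ x, (iterD (m + 1) σ φ x) ^ 2 * p x)
        + ∑ σ : Fin (m + 1) → Fin d, ∫ x, (Gfun p h φ m σ x) ^ 2 * p x := by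
  have hI : ∀ (σ : Fin (m + 1) → Fin d) (i : Fin d),
      Integrable (fun x => (pd i (iterD (m + 1) σ φ) x) ^ 2 * p x) := by
    intro σ i
    have c1 := (pd_contDiff (iterD_contDiff hφ (m + 1) σ) i).continuous
    have c2 := hp.continuous
    refine (hint2 σ).mono' (by fun_prop) (Filter.Eventually.of_forall fun x => ?_)
    rw [Real.norm_eq_abs, abs_of_nonneg (mul_nonneg (sq_nonneg _) (hppos x).le)]
    refine mul_le_mul_of_nonneg_right ?_ (hppos x).le
    exact Finset.single_le_sum (f := fun i => (pd i (iterD (m + 1) σ φ) x) ^ 2)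
      (fun j _ => sq_nonneg _) (Finset.mem_univ i)
  have hsum : (∑ σ : Fin (m + 2) → Fin d, ∫ x, (iterD (m + 2) σ φ x) ^ 2 * p x) =
      ∑ σ : Fin (m + 1) → Fin d, ∫ x, (∑ i, (pd i (iterD (m + 1) σ φ) x) ^ 2) * p x := by
    rw [← (Fin.snocEquiv (fun _ : Fin (m + 2) => Fin d)).sum_comp, Fintype.sum_prod_type_right]
    refine Finset.sum_congr rfl fun σ _ => ?_
    simp_rw [Finset.sum_mul]
    rw [integral_finsetSum _ (fun i _ => hI σ i)]
    refine Finset.sum_congr rfl fun i _ => ?_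
    have e : iterD (m + 2) ((Fin.snocEquiv (fun _ : Fin (m + 2) => Fin d)) (i, σ)) φ
        = pd i (iterD (m + 1) σ φ) := by
      have e1 : ((Fin.snocEquiv (fun _ : Fin (m + 2) => Fin d)) (i, σ)) (Fin.last (m + 1)) = i := by
        simp [Fin.snocEquiv]
      have e2 : ((Fin.snocEquiv (fun _ : Fin (m + 2) => Fin d)) (i, σ)) ∘ Fin.castSucc = σ := by
        funext j
        simp [Fin.snocEquiv]
      rw [iterD, e1, e2]
    rw [e]
  rw [hsum, ← Finset.sum_add_distrib]
  exact Finset.sum_le_sum fun σ _ =>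
    energy hp (iterD_contDiff hφ _ _) (Gfun_contDiff hp hh hφ hppos m σ) hppos
      (identity hp hh hφ hppos hhat heq m σ) (hint1 σ) (hint2 σ) (hint3 σ)
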